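/- arXiv:math/0012061 — 4 statements merged into one kernel-verified Lean document; each statement's English description precedes it below -/
import Mathlib

section
/- Let M(S,C) be an abelian poset category, i.e. each C(α) is an abelian category and each transition functor φ_{αβ} is right exact. Then M(S,C) is an abelian category, where kernels and cokernels of a morphism f: F → G are computed componentwise: Ker(f)_α = Ker(f_α) and Coker(f)_α = Coker(f_α) for every α ∈ S. -/
open CategoryTheory CategoryTheory.Limits

universe w v u

/-- A diagram of categories indexed by a poset `S`: for `β ≤ α`, a transition functor
`φ : C α ⥤ C β`, strictly functorial. -/
structure PosetDiagram (S : Type) [PartialOrder S] where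
  C : S → Type u
  cat : ∀ α, Category.{v} (C α)
  φ : ∀ {α β : S}, β ≤ α → (C α ⥤ C β)
  φ_refl : ∀ α, φ (le_refl α) = 𝟭 (C α)
  φ_trans : ∀ {α β γ : S} (h₁ : β ≤ α) (h₂ : γ ≤ β), φ (h₂.trans h₁) = φ h₁ ⋙ φ h₂

attribute [instance] PosetDiagram.cat

variable {S : Type} [PartialOrder S]

/-- Objects of the poset category `M(S,C)`. -/
structure ConfObj (D : PosetDiagram S) where
  F : ∀ α, D.C α
  σ : ∀ {α β : S} (h : β ≤ α), (D.φ h).obj (F α) ⟶ F β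
  σ_refl : ∀ α, σ (le_refl α) = eqToHom (by rw [D.φ_refl]; rfl)
  σ_trans : ∀ {α β γ : S} (h₁ : β ≤ α) (h₂ : γ ≤ β),
      σ (h₂.trans h₁) = eqToHom (by rw [D.φ_trans h₁ h₂]; rfl) ≫ (D.φ h₂).map (σ h₁) ≫ σ h₂

/-- Morphisms in the poset category `M(S,C)`. -/
@[ext]
structure ConfHom {D : PosetDiagram S} (F G : ConfObj D) where
  f : ∀ α, F.F α ⟶ G.F α
  comm : ∀ {α β : S} (h : β ≤ α), (D.φ h).map (f α) ≫ G.σ h = F.σ h ≫ f β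

/-- The poset category `M(S,C)`. -/
instance confCategory (D : PosetDiagram S) : Category (ConfObj D) where
  Hom F G := ConfHom F G
  id F := ⟨fun _ => 𝟙 _, by intro α β h; simp⟩
  comp u v := ⟨fun α => u.f α ≫ v.f α, by
    intro α β h
    rw [Functor.map_comp, Category.assoc, v.comm h, ← Category.assoc, u.comm h, Category.assoc]⟩
  id_comp u := by apply ConfHom.ext; funext α; exact Category.id_comp _
  comp_id u := by apply ConfHom.ext; funext α; exact Category.comp_id _
  assoc u v w := by apply ConfHom.ext; funext α; exact Category.assoc _ _ _

@[simp] lemma conf_id_f (D : PosetDiagram S) (F : ConfObj D) (α : S) :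
    (𝟙 F : ConfHom F F).f α = 𝟙 (F.F α) := rfl

@[simp] lemma conf_comp_f (D : PosetDiagram S) {F G H : ConfObj D} (u : F ⟶ G) (v : G ⟶ H)
    (α : S) : (u ≫ v).f α = u.f α ≫ v.f α := rfl

/-- The evaluation functor `j_α^* : M(S,C) ⥤ C(α)`. -/
def evalF (D : PosetDiagram S) (α : S) : ConfObj D ⥤ D.C α where
  obj F := F.F α
  map u := u.f α

/-- Restriction of a poset diagram to a subset of the poset. -/
def PosetDiagram.restrict (D : PosetDiagram S) (T : Set S) : PosetDiagram T where
  C t := D.C t.1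
  cat t := D.cat t.1
  φ h := D.φ h
  φ_refl t := D.φ_refl t.1
  φ_trans h₁ h₂ := D.φ_trans h₁ h₂

/-- The restriction functor `M(S,C) ⥤ M(T, C|_T)`. -/
def resF (D : PosetDiagram S) (T : Set S) : ConfObj D ⥤ ConfObj (D.restrict T) where
  obj F :=
    { F := fun t => F.F t.1
      σ := fun h => F.σ h
      σ_refl := fun t => F.σ_refl t.1
      σ_trans := fun h₁ h₂ => F.σ_trans h₁ h₂ }
  map u :=
    { f := fun t => u.f t.1
      comm := fun h => u.comm h }

/-- `F` is supported in `T` if all components outside of `T` vanish. -/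
def SuppIn {D : PosetDiagram S} (F : ConfObj D) (T : Set S) : Prop :=
  ∀ α, α ∉ T → IsZero (F.F α)

namespace ConfAux

lemma map_eqToHom_comp {A B : Type u} [Category.{v} A] [Category.{v} B] {P Q : A ⥤ B}
    (e : P = Q) {X Y : A} (f : X ⟶ Y) (h₁ : P.obj Y = Q.obj Y) (h₂ : P.obj X = Q.obj X) :
    P.map f ≫ eqToHom h₁ = eqToHom h₂ ≫ Q.map f := by
  subst e; simp

lemma hom_ext {D : PosetDiagram.{v, u} S} {F G : ConfObj D} {u v : F ⟶ G}
    (h : ∀ α, u.f α = v.f α) : u = v :=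
  ConfHom.ext (funext h)

section lim

variable {D : PosetDiagram.{v, u} S} {J : Type} [Category.{0} J] (K : J ⥤ ConfObj D)

lemma K_comm {i j : J} (g : i ⟶ j) {α β : S} (h : β ≤ α) :
    (D.φ h).map ((K.map g).f α) ≫ (K.obj j).σ h = (K.obj i).σ h ≫ (K.map g).f β :=
  (K.map g).comm h

/-- projection -/
def pr {α : S} (c : Cone (K ⋙ evalF D α)) (j : J) : c.pt ⟶ (K.obj j).F α := c.π.app j

/-- injection -/
def inj {α : S} (c : Cocone (K ⋙ evalF D α)) (j : J) : (K.obj j).F α ⟶ c.pt := c.ι.app j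

lemma cone_w {α : S} (c : Cone (K ⋙ evalF D α)) {i j : J} (g : i ⟶ j) :
    pr K c i ≫ (K.map g).f α = pr K c j := c.w g

lemma cocone_w {α : S} (c : Cocone (K ⋙ evalF D α)) {i j : J} (g : i ⟶ j) :
    (K.map g).f α ≫ inj K c j = inj K c i := c.w g

/-- transition cone -/
def sCone {α β : S} (h : β ≤ α) (c : Cone (K ⋙ evalF D α)) : Cone (K ⋙ evalF D β) where
  pt := (D.φ h).obj c.pt
  π :=
    { app := fun j => (D.φ h).map (pr K c j) ≫ (K.obj j).σ h
      naturality := by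
        intro i j g
        have h1 := K_comm K g h
        have h2 := cone_w K c g
        change 𝟙 _ ≫ (D.φ h).map (pr K c j) ≫ (K.obj j).σ h =
          ((D.φ h).map (pr K c i) ≫ (K.obj i).σ h) ≫ (K.map g).f β
        rw [Category.id_comp, Category.assoc, ← h1, ← h2, Functor.map_comp, Category.assoc] }

variable (c : ∀ α, Cone (K ⋙ evalF D α)) (hc : ∀ α, IsLimit (c α))

/-- structure map of the limit -/
def limσ {α β : S} (h : β ≤ α) : (D.φ h).obj (c α).pt ⟶ (c β).pt :=
  (hc β).lift (sCone K h (c α))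

lemma limσ_π {α β : S} (h : β ≤ α) (j : J) :
    limσ K c hc h ≫ pr K (c β) j = (D.φ h).map (pr K (c α) j) ≫ (K.obj j).σ h :=
  (hc β).fac (sCone K h (c α)) j

lemma pr_ext (hc : ∀ α, IsLimit (c α)) {α : S} {Z : D.C α} {p q : Z ⟶ (c α).pt}
    (h : ∀ j, p ≫ pr K (c α) j = q ≫ pr K (c α) j) : p = q :=
  (hc α).hom_ext h

/-- the limit -/
def limObj : ConfObj D where
  F α := (c α).pt
  σ h := limσ K c hc h
  σ_refl α := by
    apply pr_ext K c hc
    intro j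
    rw [limσ_π, (K.obj j).σ_refl]
    exact map_eqToHom_comp (D.φ_refl α) _ _ _
  σ_trans {α β γ} h₁ h₂ := by
    apply pr_ext K c hc
    intro j
    rw [limσ_π, (K.obj j).σ_trans h₁ h₂, ← Category.assoc,
      map_eqToHom_comp (D.φ_trans h₁ h₂) (pr K (c α) j) _
      (by rw [D.φ_trans h₁ h₂])]
    simp only [Category.assoc]
    rw [limσ_π, ← Functor.map_comp_assoc, limσ_π, Functor.map_comp_assoc]
    rfl

/-- the limit cone -/
def limCone : Cone K where
  pt := limObj K c hc
  π :=
    { app := fun j => ⟨fun α => pr K (c α) j, fun h => (limσ_π K c hc h j).symm⟩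
      naturality := by
        intro i j g
        apply hom_ext
        intro α
        exact (c α).π.naturality g }

/-- lift -/
def lft (s : Cone K) (α : S) : s.pt.F α ⟶ (c α).pt := (hc α).lift ((evalF D α).mapCone s)

lemma lft_pr (s : Cone K) (α : S) (j : J) :
    lft K c hc s α ≫ pr K (c α) j = (s.π.app j).f α :=
  (hc α).fac ((evalF D α).mapCone s) j

lemma lft_comm (s : Cone K) {α β : S} (h : β ≤ α) :
    (D.φ h).map (lft K c hc s α) ≫ limσ K c hc h = s.pt.σ h ≫ lft K c hc s β := by
  apply pr_ext K c hc
  intro j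
  rw [Category.assoc, Category.assoc, lft_pr, limσ_π, ← Functor.map_comp_assoc, lft_pr]
  exact (s.π.app j).comm h

/-- limit -/
def limIsLimit : IsLimit (limCone K c hc) where
  lift s := ⟨fun α => lft K c hc s α, fun h => lft_comm K c hc s h⟩
  fac s j := by
    apply hom_ext
    intro α
    exact (hc α).fac ((evalF D α).mapCone s) j
  uniq s m hm := by
    apply hom_ext
    intro α
    apply (hc α).uniq ((evalF D α).mapCone s)
    intro j
    have := congrArg (fun z => ConfHom.f z α) (hm j)
    exact this

end lim

section colim

variable {D : PosetDiagram.{v, u} S} {J : Type} [Category.{0} J] (K : J ⥤ ConfObj D)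

variable (c : ∀ α, Cocone (K ⋙ evalF D α)) (hc : ∀ α, IsColimit (c α))
  (hφ : ∀ {α β : S} (h : β ≤ α), PreservesColimitsOfShape J (D.φ h))

/-- target cocone -/
def tCocone {α β : S} (h : β ≤ α) : Cocone ((K ⋙ evalF D α) ⋙ D.φ h) where
  pt := (c β).pt
  ι :=
    { app := fun j => (K.obj j).σ h ≫ inj K (c β) j
      naturality := by
        intro i j g
        have h1 := K_comm K g h
        have h2 := cocone_w K (c β) g
        change (D.φ h).map ((K.map g).f α) ≫ (K.obj j).σ h ≫ inj K (c β) j =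
          ((K.obj i).σ h ≫ inj K (c β) i) ≫ 𝟙 _
        rw [Category.comp_id, ← Category.assoc, h1, ← h2, Category.assoc] }

lemma nonempty_map (hc : ∀ α, IsColimit (c α))
    (hφ : ∀ {α β : S} (h : β ≤ α), PreservesColimitsOfShape J (D.φ h)) {α β : S} (h : β ≤ α) :
    Nonempty (IsColimit ((D.φ h).mapCocone (c α))) :=
  have := hφ h
  ⟨isColimitOfPreserves (D.φ h) (hc α)⟩

lemma map_hom_ext (hc : ∀ α, IsColimit (c α))
    (hφ : ∀ {α β : S} (h : β ≤ α), PreservesColimitsOfShape J (D.φ h))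
    {α β : S} (h : β ≤ α) {Z : D.C β} {p q : (D.φ h).obj (c α).pt ⟶ Z}
    (hpq : ∀ j, (D.φ h).map (inj K (c α) j) ≫ p = (D.φ h).map (inj K (c α) j) ≫ q) :
    p = q := by
  obtain ⟨H⟩ := nonempty_map K c hc hφ h
  exact H.hom_ext hpq

/-- structure map of the colimit -/
noncomputable def colimσ {α β : S} (h : β ≤ α) : (D.φ h).obj (c α).pt ⟶ (c β).pt :=
  (nonempty_map K c hc hφ h).some.desc (tCocone K c h)

lemma ι_colimσ {α β : S} (h : β ≤ α) (j : J) :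
    (D.φ h).map (inj K (c α) j) ≫ colimσ K c hc hφ h = (K.obj j).σ h ≫ inj K (c β) j :=
  (nonempty_map K c hc hφ h).some.fac (tCocone K c h) j

/-- the colimit -/
noncomputable def colimObj : ConfObj D where
  F α := (c α).pt
  σ h := colimσ K c hc hφ h
  σ_refl α := by
    apply map_hom_ext K c hc hφ
    intro j
    rw [ι_colimσ, (K.obj j).σ_refl]
    exact (map_eqToHom_comp (D.φ_refl α) _ _ _).symm
  σ_trans {α β γ} h₁ h₂ := by
    apply map_hom_ext K c hc hφ
    intro j
    rw [ι_colimσ, (K.obj j).σ_trans h₁ h₂]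
    conv_rhs => rw [← Category.assoc]
    rw [map_eqToHom_comp (D.φ_trans h₁ h₂) (inj K (c α) j) _
      (by rw [D.φ_trans h₁ h₂])]
    simp only [Category.assoc, Functor.comp_map]
    rw [← Functor.map_comp_assoc, ι_colimσ, Functor.map_comp_assoc, ι_colimσ]

/-- the colimit cocone -/
noncomputable def colimCocone : Cocone K where
  pt := colimObj K c hc hφ
  ι :=
    { app := fun j => ⟨fun α => inj K (c α) j, fun h => ι_colimσ K c hc hφ h j⟩
      naturality := by
        intro i j g
        apply hom_ext
        intro α
        exact (c α).ι.naturality g }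

/-- desc -/
def dsc (s : Cocone K) (α : S) : (c α).pt ⟶ s.pt.F α := (hc α).desc ((evalF D α).mapCocone s)

lemma inj_dsc (s : Cocone K) (α : S) (j : J) :
    inj K (c α) j ≫ dsc K c hc s α = (s.ι.app j).f α :=
  (hc α).fac ((evalF D α).mapCocone s) j

lemma dsc_comm (s : Cocone K) {α β : S} (h : β ≤ α) :
    (D.φ h).map (dsc K c hc s α) ≫ s.pt.σ h = colimσ K c hc hφ h ≫ dsc K c hc s β := by
  apply map_hom_ext K c hc hφ
  intro j
  rw [← Functor.map_comp_assoc, inj_dsc, ← Category.assoc, ι_colimσ, Category.assoc, inj_dsc]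
  exact (s.ι.app j).comm h

/-- colimit -/
noncomputable def colimIsColimit : IsColimit (colimCocone K c hc hφ) where
  desc s := ⟨fun α => dsc K c hc s α, fun h => dsc_comm K c hc hφ s h⟩
  fac s j := by
    apply hom_ext
    intro α
    exact (hc α).fac ((evalF D α).mapCocone s) j
  uniq s m hm := by
    apply hom_ext
    intro α
    apply (hc α).uniq ((evalF D α).mapCocone s)
    intro j
    have := congrArg (fun z => ConfHom.f z α) (hm j)
    exact this

end colim

section shapes

variable (D : PosetDiagram.{v, u} S) (J : Type) [Category.{0} J]

lemma hasLimits [∀ α, HasLimitsOfShape J (D.C α)] : HasLimitsOfShape J (ConfObj D) :=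
  ⟨fun K => ⟨⟨⟨_, limIsLimit K (fun _ => limit.cone _) (fun _ => limit.isLimit _)⟩⟩⟩⟩

lemma presLimits [∀ α, HasLimitsOfShape J (D.C α)] (α : S) :
    PreservesLimitsOfShape J (evalF D α) :=
  ⟨fun {K} => preservesLimit_of_preserves_limit_cone
    (limIsLimit K (fun _ => limit.cone _) (fun _ => limit.isLimit _))
    (limit.isLimit (K ⋙ evalF D α))⟩

lemma hasColimits [∀ α, HasColimitsOfShape J (D.C α)]
    (hφ : ∀ {α β : S} (h : β ≤ α), PreservesColimitsOfShape J (D.φ h)) :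
    HasColimitsOfShape J (ConfObj D) :=
  ⟨fun K => ⟨⟨⟨_, colimIsColimit K (fun _ => colimit.cocone _)
    (fun _ => colimit.isColimit _) hφ⟩⟩⟩⟩

lemma presColimits [∀ α, HasColimitsOfShape J (D.C α)]
    (hφ : ∀ {α β : S} (h : β ≤ α), PreservesColimitsOfShape J (D.φ h)) (α : S) :
    PreservesColimitsOfShape J (evalF D α) :=
  ⟨fun {K} => preservesColimit_of_preserves_colimit_cocone
    (colimIsColimit K (fun _ => colimit.cocone _) (fun _ => colimit.isColimit _) hφ)
    (colimit.isColimit (K ⋙ evalF D α))⟩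

end shapes

lemma isIso_of {D : PosetDiagram.{v, u} S} {F G : ConfObj D} (m : F ⟶ G)
    (h : ∀ α, IsIso (m.f α)) : IsIso m := by
  refine ⟨⟨⟨fun α => inv (m.f α), ?_⟩, ?_, ?_⟩⟩
  · intro α β h
    rw [Functor.map_inv, IsIso.inv_comp_eq, ← Category.assoc, m.comm h]
    simp
  · apply hom_ext
    intro α
    exact IsIso.hom_inv_id (m.f α)
  · apply hom_ext
    intro α
    exact IsIso.inv_hom_id (m.f α)

section preadd

variable (D : PosetDiagram.{v, u} S) [∀ α : S, Preadditive (D.C α)]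
  (hφ : ∀ {α β : S} (h : β ≤ α), (D.φ h).Additive)

/-- group structure -/
@[reducible] def homGroup (F G : ConfObj D) : AddCommGroup (F ⟶ G) :=
  let A : Add (F ⟶ G) := ⟨fun u v => ⟨fun α => u.f α + v.f α, by
    intro α β h
    have := hφ h
    simp [Functor.map_add, u.comm, v.comm]⟩⟩
  let Z : Zero (F ⟶ G) := ⟨⟨fun α => 0, by
    intro α β h
    have := hφ h
    simp⟩⟩
  let N : Neg (F ⟶ G) := ⟨fun u => ⟨fun α => - u.f α, by
    intro α β h
    have := hφ h
    simp [Functor.map_neg, u.comm]⟩⟩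
  { add_assoc := fun a b c => hom_ext fun α => add_assoc (a.f α) (b.f α) (c.f α)
    zero_add := fun a => hom_ext fun α => zero_add (a.f α)
    add_zero := fun a => hom_ext fun α => add_zero (a.f α)
    neg_add_cancel := fun a => hom_ext fun α => neg_add_cancel (a.f α)
    add_comm := fun a b => hom_ext fun α => add_comm (a.f α) (b.f α)
    nsmul := nsmulRec
    zsmul := zsmulRec }

/-- preadditive structure -/
@[reducible] def preadd : Preadditive (ConfObj D) where
  homGroup := homGroup D hφ
  add_comp _ _ _ f f' g :=
    hom_ext fun α => Preadditive.add_comp _ _ _ (f.f α) (f'.f α) (g.f α)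
  comp_add _ _ _ f g g' :=
    hom_ext fun α => Preadditive.comp_add _ _ _ (f.f α) (g.f α) (g'.f α)

end preadd

end ConfAux

/-- Lemma 2.2 of "Coherent sheaves on configuration schemes":
an abelian poset category `M(S,C)` (each `C(α)` abelian, each transition functor `φ_{αβ}`
right exact, i.e. preserving finite colimits) is an abelian category, in which kernels and
cokernels are computed componentwise; the latter is expressed by saying that each evaluation
functor `F ↦ F_α` preserves kernels and cokernels (limits and colimits of parallel pairs). -/
theorem abelian_poset_category_is_abelian (S : Type) [PartialOrder S]
    (D : PosetDiagram.{v, u} S) [∀ α : S, Abelian (D.C α)]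
    (hφ : ∀ {α β : S} (h : β ≤ α), PreservesFiniteColimits (D.φ h)) :
    Nonempty (Abelian (ConfObj D)) ∧
      ∀ α : S, PreservesLimitsOfShape WalkingParallelPair (evalF D α) ∧
        PreservesColimitsOfShape WalkingParallelPair (evalF D α) := by
  have hadd : ∀ {α β : S} (h : β ≤ α), (D.φ h).Additive := by
    intro α β h
    have := hφ h
    have : (D.φ h).PreservesZeroMorphisms :=
      Functor.preservesZeroMorphisms_of_preserves_initial_object
    have := preservesBinaryBiproducts_of_preservesBinaryCoproducts (D.φ h)
    exact Functor.additive_of_preservesBinaryBiproducts _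
  have hpp : ∀ {α β : S} (h : β ≤ α),
      PreservesColimitsOfShape WalkingParallelPair (D.φ h) := by
    intro α β h
    have := hφ h
    infer_instance
  have hl := fun α => ConfAux.presLimits D WalkingParallelPair α
  have hr := fun α => ConfAux.presColimits D WalkingParallelPair hpp α
  refine ⟨?_, fun α => ⟨hl α, hr α⟩⟩
  letI := ConfAux.preadd D hadd
  have hE := ConfAux.hasLimits D WalkingParallelPair
  have hC := ConfAux.hasColimits D WalkingParallelPair hpp
  have hP : HasFiniteProducts (ConfObj D) :=
    ⟨fun n => ConfAux.hasLimits D (Discrete (Fin n))⟩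
  have : HasKernels (ConfObj D) := ⟨fun f => inferInstance⟩
  have : HasCokernels (ConfObj D) := ⟨fun f => inferInstance⟩
  have hz : ∀ α, (evalF D α).PreservesZeroMorphisms := fun α => ⟨fun _ _ => rfl⟩
  have : ∀ {X Y : ConfObj D} (f : X ⟶ Y), IsIso (Abelian.coimageImageComparison f) := by
    intro X Y f
    apply ConfAux.isIso_of
    intro α
    change IsIso ((evalF D α).map (Abelian.coimageImageComparison f))
    have := hl α
    have := hr α
    have := Arrow.isIso_iff_isIso_of_isIso
      (Abelian.PreservesCoimageImageComparison.iso (evalF D α) f).hom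
    exact this.2 (inferInstanceAs (IsIso (Abelian.coimageImageComparison ((evalF D α).map f))))
  exact ⟨Abelian.ofCoimageImageComparisonIsIso⟩
end

section
/- Let M(S,C) be a configuration category and α ∈ S. Then the evaluation functor j_α^*: M(S,C) → C(α), F ↦ F_α, has a right adjoint j_{α*}, defined by (j_{α*}P)_γ = ψ_{αγ}(P) if γ ≥ α and 0 otherwise, with structure maps given by the adjunction counits. The functor j_{α*} is exact, preserves injective objects, and for every P ∈ C(α) the support of j_{α*}P is contained in Z_α = {γ ∈ S : γ ≥ α}. -/
open CategoryTheory CategoryTheory.Limits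

universe w v u

variable {S : Type} [PartialOrder S]

section helpers

lemma exists_family (D : PosetDiagram.{v, u} S) [∀ α : S, Abelian (D.C α)]
    (ψ : ∀ {α β : S}, β ≤ α → (D.C β ⥤ D.C α))
    (adj : ∀ {α β : S} (h : β ≤ α), D.φ h ⊣ ψ h)
    (ψrex : ∀ {α β : S} (h : β ≤ α), PreservesFiniteColimits (ψ h))
    (α γ : S) : ∃ J : D.C α ⥤ D.C γ, PreservesFiniteColimits J ∧
      (¬ α ≤ γ → ∀ P, IsZero (J.obj P)) ∧
      (∀ h : α ≤ γ, Nonempty (J ≅ ψ h)) ∧ (∀ h : α ≤ γ, Nonempty (D.φ h ⊣ J)) := by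
  by_cases h : α ≤ γ
  · exact ⟨ψ h, ψrex h, fun h' => absurd h h', fun _ => ⟨Iso.refl _⟩, fun _ => ⟨adj h⟩⟩
  · refine ⟨(Functor.const _).obj (HasZeroObject.zero' (D.C γ)).zero, ?_, fun _ P => isZero_zero _, fun h' => absurd h' h,
      fun h' => absurd h' h⟩
    refine ⟨fun K _ _ => ⟨fun {G} => ⟨fun {c} _ => ⟨?_⟩⟩⟩⟩
    exact
      { desc := fun s => 0
        fac := fun s j => (isZero_zero (D.C γ)).eq_of_src _ _
        uniq := fun s m _ => (isZero_zero (D.C γ)).eq_of_src _ _ }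

/-- The data of the components of the right adjoint. -/
structure RData (D : PosetDiagram.{v, u} S) (α : S) where
  J : ∀ γ, D.C α ⥤ D.C γ
  z : ∀ γ, ¬ α ≤ γ → ∀ P, IsZero ((J γ).obj P)
  adj : ∀ {γ} (h : α ≤ γ), D.φ h ⊣ J γ

namespace RData

variable {D : PosetDiagram.{v, u} S} {α : S} (E : RData D α)

/-- counit -/
def ε {γ : S} (h : α ≤ γ) (P : D.C α) : (D.φ h).obj ((E.J γ).obj P) ⟶ P :=
  (E.adj h).counit.app P

lemma ε_nat {γ : S} (h : α ≤ γ) {P Q : D.C α} (f : P ⟶ Q) :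
    (D.φ h).map ((E.J γ).map f) ≫ E.ε h Q = E.ε h P ≫ f :=
  (E.adj h).counit.naturality f

open Classical in
/-- universal property -/
noncomputable def lift {γ : S} {X : D.C γ} {P : D.C α}
    (u : ∀ h : α ≤ γ, (D.φ h).obj X ⟶ P) : X ⟶ (E.J γ).obj P :=
  if h : α ≤ γ then (E.adj h).homEquiv _ _ (u h) else (E.z γ h P).from_ X

lemma lift_ε {γ : S} {X : D.C γ} {P : D.C α}
    (u : ∀ h : α ≤ γ, (D.φ h).obj X ⟶ P) (h : α ≤ γ) :
    (D.φ h).map (E.lift u) ≫ E.ε h P = u h := by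
  rw [lift, dif_pos h]
  have := (E.adj h).homEquiv_counit (g := (E.adj h).homEquiv _ _ (u h))
  rw [Equiv.symm_apply_apply] at this
  exact this.symm

lemma hom_ext {γ : S} {X : D.C γ} {P : D.C α} {f g : X ⟶ (E.J γ).obj P}
    (H : ∀ h : α ≤ γ, (D.φ h).map f ≫ E.ε h P = (D.φ h).map g ≫ E.ε h P) : f = g := by
  by_cases h : α ≤ γ
  · apply ((E.adj h).homEquiv _ _).symm.injective
    rw [Adjunction.homEquiv_counit, Adjunction.homEquiv_counit]
    exact H h
  · exact (E.z γ h P).eq_of_tgt _ _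

end RData

lemma φ_map_trans (D : PosetDiagram.{v, u} S) {a b c : S} (h₁ : b ≤ a) (h₂ : c ≤ b)
    {X Y : D.C a} (f : X ⟶ Y) : (D.φ h₂).map ((D.φ h₁).map f) =
      eqToHom (by rw [D.φ_trans h₁ h₂]; rfl) ≫ (D.φ (h₂.trans h₁)).map f ≫
        eqToHom (by rw [D.φ_trans h₁ h₂]; rfl) := by
  have := Functor.congr_hom (D.φ_trans h₁ h₂) f
  rw [this]
  simp

lemma φ_map_refl (D : PosetDiagram.{v, u} S) {a : S}
    {X Y : D.C a} (f : X ⟶ Y) : (D.φ (le_refl a)).map f =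
      eqToHom (by rw [D.φ_refl]; rfl) ≫ f ≫ eqToHom (by rw [D.φ_refl]; rfl) := by
  have := Functor.congr_hom (D.φ_refl a) f
  rw [this]
  simp

namespace RData

variable {D : PosetDiagram.{v, u} S} {α : S} (E : RData D α)

/-- structure maps -/
noncomputable def s (P : D.C α) {a b : S} (h : b ≤ a) :
    (D.φ h).obj ((E.J a).obj P) ⟶ (E.J b).obj P :=
  E.lift (fun h' => eqToHom (by rw [D.φ_trans h h']; rfl) ≫ E.ε (h'.trans h) P)

lemma s_ε (P : D.C α) {a b : S} (h : b ≤ a) (h' : α ≤ b) :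
    (D.φ h').map (E.s P h) ≫ E.ε h' P =
      eqToHom (by rw [D.φ_trans h h']; rfl) ≫ E.ε (h'.trans h) P :=
  E.lift_ε _ _

lemma s_nat {P Q : D.C α} (f : P ⟶ Q) {a b : S} (h : b ≤ a) :
    (D.φ h).map ((E.J a).map f) ≫ E.s Q h = E.s P h ≫ (E.J b).map f := by
  apply E.hom_ext
  intro h'
  rw [Functor.map_comp, Functor.map_comp, Category.assoc, Category.assoc, s_ε, ε_nat,
    ← Category.assoc _ _ f, s_ε, φ_map_trans]
  simp [ε_nat]

lemma lift_s {F : ConfObj D} {P : D.C α} (a : F.F α ⟶ P) {c b : S} (h : b ≤ c) :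
    (D.φ h).map (E.lift (fun h => F.σ h ≫ a)) ≫ E.s P h =
      F.σ h ≫ E.lift (fun h => F.σ h ≫ a) := by
  apply E.hom_ext
  intro h'
  rw [Functor.map_comp, Functor.map_comp, Category.assoc, Category.assoc, s_ε, lift_ε,
    φ_map_trans]
  simp only [Category.assoc, eqToHom_trans_assoc, eqToHom_refl, Category.id_comp]
  rw [lift_ε, F.σ_trans h h']
  simp

/-- the identification at `α` -/
def e (P : D.C α) : (E.J α).obj P ⟶ P :=
  eqToHom (by rw [D.φ_refl]; rfl) ≫ E.ε (le_refl α) P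

lemma e_nat {P Q : D.C α} (g : P ⟶ Q) : (E.J α).map g ≫ E.e Q = E.e P ≫ g := by
  have := E.ε_nat (le_refl α) g
  rw [φ_map_refl] at this
  rw [e, e, Category.assoc, ← this]
  simp

lemma map_refl_ε {X : D.C α} {P : D.C α} (f : X ⟶ (E.J α).obj P) :
    (D.φ (le_refl α)).map f ≫ E.ε (le_refl α) P =
      eqToHom (by rw [D.φ_refl]; rfl) ≫ f ≫ E.e P := by
  rw [φ_map_refl, e]
  simp

lemma lift_e {F : ConfObj D} {P : D.C α} (a : F.F α ⟶ P) :
    E.lift (fun h => F.σ h ≫ a) ≫ E.e P = a := by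
  have h1 := E.lift_ε (fun h : α ≤ α => F.σ h ≫ a) (le_refl α)
  rw [map_refl_ε, F.σ_refl] at h1
  exact (cancel_epi _).1 h1

lemma s_e (P : D.C α) {γ : S} (h : α ≤ γ) : E.s P h ≫ E.e P = E.ε h P := by
  have h3 := E.s_ε P h (le_refl α)
  rw [map_refl_ε] at h3
  exact (cancel_epi _).1 h3

lemma key {F : ConfObj D} {P : D.C α} {γ : S} (h : α ≤ γ) (x : F.F γ ⟶ (E.J γ).obj P)
    (y : F.F α ⟶ (E.J α).obj P) (H : (D.φ h).map x ≫ E.s P h = F.σ h ≫ y) :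
    (D.φ h).map x ≫ E.ε h P = F.σ h ≫ y ≫ E.e P := by
  rw [← s_e, ← Category.assoc, H, Category.assoc]

/-- objects -/
noncomputable def robj (P : D.C α) : ConfObj D where
  F γ := (E.J γ).obj P
  σ h := E.s P h
  σ_refl a := by
    apply E.hom_ext
    intro h
    rw [s_ε, eqToHom_map]
  σ_trans {a b c} h₁ h₂ := by
    apply E.hom_ext
    intro h
    rw [s_ε]
    simp only [Functor.map_comp, Category.assoc, eqToHom_map]
    rw [s_ε, φ_map_trans]
    simp only [Category.assoc, eqToHom_trans_assoc, eqToHom_refl, Category.id_comp]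
    rw [s_ε]
    simp only [eqToHom_trans_assoc]

/-- the right adjoint -/
noncomputable def R : D.C α ⥤ ConfObj D where
  obj P := E.robj P
  map {P Q} f :=
    { f := fun γ => (E.J γ).map f
      comm := fun h => E.s_nat f h }
  map_id P := by apply ConfHom.ext; funext γ; exact (E.J γ).map_id P
  map_comp f g := by apply ConfHom.ext; funext γ; exact (E.J γ).map_comp f g

/-- hom from right to left -/
noncomputable def toR {F : ConfObj D} {P : D.C α} (a : F.F α ⟶ P) : F ⟶ E.R.obj P :=
  ConfHom.mk (fun γ => E.lift (fun h => F.σ h ≫ a)) (fun h => E.lift_s a h)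

lemma toR_e {F : ConfObj D} {P : D.C α} (a : F.F α ⟶ P) :
    (E.toR a).f α ≫ E.e P = a := E.lift_e a

lemma ext_R {F : ConfObj D} {P : D.C α} (f g : F ⟶ E.R.obj P)
    (H : f.f α ≫ E.e P = g.f α ≫ E.e P) : f = g := by
  apply ConfHom.ext
  funext γ
  apply E.hom_ext
  intro h
  exact (E.key h (f.f γ) (f.f α) (f.comm h)).trans
    ((congrArg (fun t => F.σ h ≫ t) H).trans (E.key h (g.f γ) (g.f α) (g.comm h)).symm)

lemma nat_right {F : ConfObj D} {P Q : D.C α} (f : F.F α ⟶ P) (g : P ⟶ Q) :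
    E.lift (fun h => F.σ h ≫ f ≫ g) ≫ E.e Q =
      (E.lift (fun h => F.σ h ≫ f) ≫ (E.J α).map g) ≫ E.e Q := by
  rw [lift_e, Category.assoc, e_nat, ← Category.assoc, lift_e]

/-- the adjunction -/
noncomputable def adjR : evalF D α ⊣ E.R :=
  Adjunction.mkOfHomEquiv
    { homEquiv := fun F P =>
        { toFun := fun a => E.toR a
          invFun := fun f => f.f α ≫ E.e P
          left_inv := fun a => E.toR_e a
          right_inv := fun f => E.ext_R _ _ (E.toR_e _) }
      homEquiv_naturality_left_symm := by
        intro F' F P f g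
        exact Category.assoc _ _ _
      homEquiv_naturality_right := by
        intro F P Q f g
        apply E.ext_R
        exact E.nat_right (F := F) f g }

end RData

lemma colim_aux {A B : Type u} [Category.{v} A] [Category.{v} B] (Φ : A ⥤ B)
    {x y z : A} {x' y' z' : B} (i : x ⟶ y) (d : y ⟶ z) (i' : x' ⟶ y') (d' : y' ⟶ z')
    (t : x ⟶ z) (t' : x' ⟶ z') (sx : Φ.obj x ⟶ x') (sy : Φ.obj y ⟶ y') (sz : Φ.obj z ⟶ z')
    (h1 : i ≫ d = t) (h2 : i' ≫ d' = t') (h3 : Φ.map i ≫ sy = sx ≫ i')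
    (h4 : Φ.map t ≫ sz = sx ≫ t') : Φ.map i ≫ Φ.map d ≫ sz = Φ.map i ≫ sy ≫ d' := by
  rw [← Functor.map_comp_assoc, h1, h4, ← Category.assoc, h3, Category.assoc, h2]

/-- Colimits in `M(S,C)` are computed componentwise. -/
noncomputable def isColimitOfEval (D : PosetDiagram.{v, u} S) {K : Type} [SmallCategory K]
    {G : K ⥤ ConfObj D} (c : Cocone G)
    (hφ : ∀ {α β : S} (h : β ≤ α), PreservesColimitsOfShape K (D.φ h))
    (hc : ∀ γ, IsColimit ((evalF D γ).mapCocone c)) : IsColimit c where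
  desc t := ConfHom.mk (fun γ => (hc γ).desc ((evalF D γ).mapCocone t)) (by
    intro a b h
    haveI := hφ h
    apply (isColimitOfPreserves (D.φ h) (hc a)).hom_ext
    intro j
    exact colim_aux (D.φ h) ((c.ι.app j).f a) _ ((c.ι.app j).f b) _ ((t.ι.app j).f a)
      ((t.ι.app j).f b) ((G.obj j).σ h) (c.pt.σ h) (t.pt.σ h)
      ((hc a).fac ((evalF D a).mapCocone t) j) ((hc b).fac ((evalF D b).mapCocone t) j)
      ((c.ι.app j).comm h) ((t.ι.app j).comm h))
  fac t j := by
    apply ConfHom.ext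
    funext γ
    exact (hc γ).fac ((evalF D γ).mapCocone t) j
  uniq t m hm := by
    apply ConfHom.ext
    funext γ
    apply (hc γ).uniq ((evalF D γ).mapCocone t)
    intro j
    exact congrArg (fun u => ConfHom.f u γ) (hm j)

/-- componentwise kernel -/
noncomputable def kerObj (D : PosetDiagram.{v, u} S) [∀ α : S, Abelian (D.C α)]
    (hφ : ∀ {α β : S} (h : β ≤ α), (D.φ h).PreservesZeroMorphisms)
    {F G : ConfObj D} (f : F ⟶ G) : ConfObj D where
  F γ := kernel (f.f γ)
  σ {a b} h := kernel.lift (f.f b) ((D.φ h).map (kernel.ι (f.f a)) ≫ F.σ h) (by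
    haveI := hφ h
    rw [Category.assoc, ← f.comm h, ← Category.assoc, ← Functor.map_comp, kernel.condition,
      Functor.map_zero, zero_comp])
  σ_refl a := by
    rw [← cancel_mono (kernel.ι _), kernel.lift_ι, φ_map_refl, F.σ_refl]
    simp
  σ_trans {a b c} h₁ h₂ := by
    rw [← cancel_mono (kernel.ι _), kernel.lift_ι]
    simp only [Category.assoc, kernel.lift_ι]
    rw [← Functor.map_comp_assoc, kernel.lift_ι, F.σ_trans h₁ h₂, Functor.map_comp, φ_map_trans]
    simp

lemma mono_eval (D : PosetDiagram.{v, u} S) [∀ α : S, Abelian (D.C α)]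
    (hφ : ∀ {α β : S} (h : β ≤ α), (D.φ h).PreservesZeroMorphisms)
    {F G : ConfObj D} (f : F ⟶ G) [Mono f] (γ : S) : Mono (f.f γ) := by
  let i : kerObj D hφ f ⟶ F := ConfHom.mk (fun γ => kernel.ι (f.f γ)) (by
    intro a b h
    exact (kernel.lift_ι _ _ _).symm)
  let z : kerObj D hφ f ⟶ F := ConfHom.mk (fun γ => 0) (by
    intro a b h
    haveI := hφ h
    simp)
  have h : i = z := by
    rw [← cancel_mono f]
    apply ConfHom.ext
    funext γ
    change kernel.ι (f.f γ) ≫ f.f γ = 0 ≫ f.f γ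
    simp
  have h' : kernel.ι (f.f γ) = 0 := congrArg (fun u => ConfHom.f u γ) h
  exact Preadditive.mono_of_kernel_zero h'

end helpers

/-- Lemma 2.8: in a configuration category (finite poset `S`, each `C(α)`
abelian, each `φ_{αβ}` right exact with an exact right adjoint `ψ_{βα}`), the evaluation
functor `j_α^* : M(S,C) ⥤ C(α)` has a right adjoint `j_{α*}`, given on components by
`(j_{α*}P)_γ ≅ ψ_{αγ}(P)` for `γ ≥ α` and `0` otherwise; `j_{α*}` is exact, preserves
injective objects, and `Supp (j_{α*}P) ⊆ Z_α = {γ : γ ≥ α}`. -/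
theorem configuration_category_eval_has_exact_right_adjoint
    (S : Type) [PartialOrder S] [Fintype S]
    (D : PosetDiagram.{v, u} S) [∀ α : S, Abelian (D.C α)]
    (hφ : ∀ {α β : S} (h : β ≤ α), PreservesFiniteColimits (D.φ h))
    (ψ : ∀ {α β : S}, β ≤ α → (D.C β ⥤ D.C α))
    (adj : ∀ {α β : S} (h : β ≤ α), D.φ h ⊣ ψ h)
    (ψlex : ∀ {α β : S} (h : β ≤ α), PreservesFiniteLimits (ψ h))
    (ψrex : ∀ {α β : S} (h : β ≤ α), PreservesFiniteColimits (ψ h))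
    (α : S) :
    ∃ R : D.C α ⥤ ConfObj D,
      Nonempty (evalF D α ⊣ R) ∧
      PreservesFiniteLimits R ∧ PreservesFiniteColimits R ∧
      (∀ P : D.C α, Injective P → Injective (R.obj P)) ∧
      (∀ (P : D.C α) (γ : S),
        (¬ α ≤ γ → IsZero ((R.obj P).F γ)) ∧
        (∀ h : α ≤ γ, Nonempty ((R.obj P).F γ ≅ (ψ h).obj P))) := by
  classical
  choose J hJ hz hi ha using fun γ => exists_family D ψ adj ψrex α γ
  let E : RData D α := ⟨J, hz, fun {γ} h => (ha γ h).some⟩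
  have hz0 : ∀ {α β : S} (h : β ≤ α), (D.φ h).PreservesZeroMorphisms := by
    intro a b h
    haveI := (adj h).isLeftAdjoint
    infer_instance
  haveI : (evalF D α).PreservesMonomorphisms := ⟨fun f _ => mono_eval D hz0 f α⟩
  refine ⟨E.R, ⟨E.adjR⟩, ?_, ?_, ?_, ?_⟩
  · haveI := E.adjR.rightAdjoint_preservesLimits
    exact ⟨fun K _ _ => inferInstance⟩
  · refine ⟨fun K _ _ => ⟨fun {G} => ⟨fun {c} hc => ⟨?_⟩⟩⟩⟩
    refine isColimitOfEval D _ (fun h => ?_) (fun γ => ?_)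
    · haveI := hφ h
      infer_instance
    · haveI := hJ γ
      exact isColimitOfPreserves (J γ) hc
  · intro P hP
    exact Injective.injective_of_adjoint E.adjR P
  · intro P γ
    exact ⟨fun h => hz γ h P, fun h => ⟨(hi γ h).some.app P⟩⟩
end

section
/- Let M(S,C) be a configuration category such that each category C(α) has enough injectives. Then M(S,C) has enough injectives, i.e. every object admits a monomorphism into an injective object. -/
open CategoryTheory CategoryTheory.Limits

universe w v u

variable {S : Type} [PartialOrder S]

lemma conf_map_refl (D : PosetDiagram S) {α : S} {X Y : D.C α} (p : X ⟶ Y)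
    (h1 : X = (D.φ (le_refl α)).obj X) (h2 : Y = (D.φ (le_refl α)).obj Y) :
    p ≫ eqToHom h2 = eqToHom h1 ≫ (D.φ (le_refl α)).map p := by
  have := Functor.congr_hom (D.φ_refl α) p
  rw [this]; simp

lemma conf_map_trans (D : PosetDiagram S) {α β γ : S} (h₁ : β ≤ α) (h₂ : γ ≤ β)
    {X Y : D.C α} (p : X ⟶ Y)
    (e1 : (D.φ h₂).obj ((D.φ h₁).obj X) = (D.φ (h₂.trans h₁)).obj X)
    (e2 : (D.φ h₂).obj ((D.φ h₁).obj Y) = (D.φ (h₂.trans h₁)).obj Y) :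
    (D.φ h₂).map ((D.φ h₁).map p) ≫ eqToHom e2 = eqToHom e1 ≫ (D.φ (h₂.trans h₁)).map p := by
  have := Functor.congr_hom (D.φ_trans h₁ h₂) p
  rw [this]; simp

lemma conf_obj_trans (D : PosetDiagram S) {α β γ : S} (h₁ : β ≤ α) (h₂ : γ ≤ β) (X : D.C α) :
    (D.φ h₂).obj ((D.φ h₁).obj X) = (D.φ (h₂.trans h₁)).obj X := by
  rw [D.φ_trans h₁ h₂]; rfl

lemma conf_obj_refl (D : PosetDiagram S) {α : S} (X : D.C α) :
    X = (D.φ (le_refl α)).obj X := by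
  rw [D.φ_refl]; rfl

/-- A cofree object on the family `I`. -/
structure CofreeData (D : PosetDiagram S) (I : ∀ α, D.C α) where
  G : ∀ α, D.C α
  ev : ∀ {γ α : S} (h : α ≤ γ), (D.φ h).obj (G γ) ⟶ I α
  lift : ∀ {γ : S} {X : D.C γ} (_ : ∀ (α : S) (h : α ≤ γ), (D.φ h).obj X ⟶ I α), X ⟶ G γ
  lift_ev : ∀ {γ : S} {X : D.C γ} (t : ∀ (α : S) (h : α ≤ γ), (D.φ h).obj X ⟶ I α)
    (α : S) (h : α ≤ γ), (D.φ h).map (lift t) ≫ ev h = t α h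
  hom_ext : ∀ {γ : S} {X : D.C γ} (p q : X ⟶ G γ),
    (∀ (α : S) (h : α ≤ γ), (D.φ h).map p ≫ ev h = (D.φ h).map q ≫ ev h) → p = q

namespace CofreeData

variable {D : PosetDiagram S} {I : ∀ α, D.C α} (K : CofreeData D I)

/-- structure maps of the cofree object -/
def sig {β γ : S} (h : γ ≤ β) : (D.φ h).obj (K.G β) ⟶ K.G γ :=
  K.lift fun _ h' => eqToHom (conf_obj_trans D h h' _) ≫ K.ev (h'.trans h)

lemma sig_ev {β γ α : S} (h : γ ≤ β) (h' : α ≤ γ) :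
    (D.φ h').map (K.sig h) ≫ K.ev h' =
      eqToHom (conf_obj_trans D h h' _) ≫ K.ev (h'.trans h) := K.lift_ev _ _ _

/-- the cofree object -/
def obj : ConfObj D where
  F := K.G
  σ h := K.sig h
  σ_refl γ := by
    apply K.hom_ext
    intro α h
    rw [sig_ev, eqToHom_map]
  σ_trans {β γ δ} h₁ h₂ := by
    apply K.hom_ext
    intro α h
    rw [sig_ev, Functor.map_comp, Functor.map_comp, Category.assoc, Category.assoc, sig_ev,
      eqToHom_map, ← Category.assoc ((D.φ h).map ((D.φ h₂).map _)), conf_map_trans,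
      Category.assoc, sig_ev]
    · rw [eqToHom_trans_assoc, eqToHom_trans_assoc]
    · exact conf_obj_trans D h₂ h _

end CofreeData

/-- A cofree object on the family `I`, as an object of the poset category. -/
structure CofreeObj (D : PosetDiagram S) (I : ∀ α, D.C α) where
  obj : ConfObj D
  ev : ∀ {γ α : S} (h : α ≤ γ), (D.φ h).obj (obj.F γ) ⟶ I α
  lift : ∀ {γ : S} {X : D.C γ} (_ : ∀ (α : S) (h : α ≤ γ), (D.φ h).obj X ⟶ I α), X ⟶ obj.F γ
  lift_ev : ∀ {γ : S} {X : D.C γ} (t : ∀ (α : S) (h : α ≤ γ), (D.φ h).obj X ⟶ I α)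
    (α : S) (h : α ≤ γ), (D.φ h).map (lift t) ≫ ev h = t α h
  hom_ext : ∀ {γ : S} {X : D.C γ} (p q : X ⟶ obj.F γ),
    (∀ (α : S) (h : α ≤ γ), (D.φ h).map p ≫ ev h = (D.φ h).map q ≫ ev h) → p = q
  sig_ev : ∀ {β γ α : S} (h : γ ≤ β) (h' : α ≤ γ),
    (D.φ h').map (obj.σ h) ≫ ev h' =
      eqToHom (conf_obj_trans D h h' _) ≫ ev (h'.trans h)

/-- The cofree object from the raw data. -/
def CofreeData.toObj {D : PosetDiagram S} {I : ∀ α, D.C α} (K : CofreeData D I) :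
    CofreeObj D I where
  obj := K.obj
  ev := K.ev
  lift := K.lift
  lift_ev := K.lift_ev
  hom_ext := K.hom_ext
  sig_ev := K.sig_ev

namespace CofreeObj

variable {D : PosetDiagram S} {I : ∀ α, D.C α} (K : CofreeObj D I)

/-- lifting a family to a morphism into the cofree object -/
def liftHom {F : ConfObj D} (t : ∀ α, F.F α ⟶ I α) : F ⟶ K.obj where
  f β := K.lift fun α h => F.σ h ≫ t α
  comm {β γ} h := by
    apply K.hom_ext
    intro α h'
    rw [Functor.map_comp, Functor.map_comp, Category.assoc, Category.assoc, K.sig_ev, K.lift_ev,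
      ← Category.assoc, conf_map_trans D h h' _ (conf_obj_trans D h h' _), Category.assoc, K.lift_ev,
      F.σ_trans h h']
    simp

lemma liftHom_ev {F : ConfObj D} (t : ∀ α, F.F α ⟶ I α) {γ α : S} (h : α ≤ γ) :
    (D.φ h).map ((K.liftHom t).f γ) ≫ K.ev h = F.σ h ≫ t α := K.lift_ev _ _ _

lemma hom_ev {A : ConfObj D} (g : A ⟶ K.obj) {γ α : S} (h : α ≤ γ) :
    (D.φ h).map (g.f γ) ≫ K.ev h =
      A.σ h ≫ eqToHom (conf_obj_refl D _) ≫ (D.φ (le_refl α)).map (g.f α) ≫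
        K.ev (le_refl α) := by
  have h1 := g.comm h
  have h2 := K.sig_ev h (le_refl α)
  have h3 : K.obj.σ h ≫ eqToHom (conf_obj_refl D _) ≫ K.ev (le_refl α) = K.ev h := by
    rw [← Category.assoc, conf_map_refl D (K.obj.σ h) (conf_obj_refl D _), Category.assoc, h2]
    simp
  rw [← Category.assoc (eqToHom _), ← conf_map_refl D (g.f α) (conf_obj_refl D _) (conf_obj_refl D _),
    Category.assoc, ← Category.assoc, ← h1, Category.assoc]
  congr 1
  exact h3.symm

lemma injective_obj (hm : ∀ {A B : ConfObj D} (m : A ⟶ B), Mono m → ∀ α, Mono (m.f α))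
    (hI : ∀ α, Injective (I α)) : Injective K.obj where
  factors {A B} g m hmono := by
    have := hm m hmono
    let t : ∀ α, A.F α ⟶ I α := fun α =>
      eqToHom (conf_obj_refl D _) ≫ (D.φ (le_refl α)).map (g.f α) ≫ K.ev (le_refl α)
    let s : ∀ α, B.F α ⟶ I α := fun α => Injective.factorThru (t α) (m.f α)
    have hs : ∀ α, m.f α ≫ s α = t α := fun α => Injective.comp_factorThru _ _
    refine ⟨K.liftHom s, ?_⟩
    apply ConfHom.ext
    funext γ
    apply K.hom_ext
    intro α h
    rw [conf_comp_f, Functor.map_comp, Category.assoc, liftHom_ev, ← Category.assoc, m.comm h,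
      Category.assoc, hs, K.hom_ev g h]

lemma mono_liftHom {F : ConfObj D} (t : ∀ α, F.F α ⟶ I α) (ht : ∀ α, Mono (t α)) :
    Mono (K.liftHom t) where
  right_cancellation {Z} p q hpq := by
    apply ConfHom.ext
    funext α
    have key : ∀ p : Z ⟶ F, (D.φ (le_refl α)).map ((p ≫ K.liftHom t).f α) ≫ K.ev (le_refl α)
        = Z.σ (le_refl α) ≫ p.f α ≫ t α := by
      intro p
      rw [conf_comp_f, Functor.map_comp, Category.assoc, liftHom_ev, ← Category.assoc,
        p.comm, Category.assoc]
    have h := key p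
    rw [hpq, key q] at h
    rw [Z.σ_refl, cancel_epi, cancel_mono] at h
    exact h.symm

end CofreeObj

lemma conf_mono_f (D : PosetDiagram S) [∀ α : S, Abelian (D.C α)]
    (hz : ∀ {α β : S} (h : β ≤ α), (D.φ h).PreservesZeroMorphisms)
    {A B : ConfObj D} (m : A ⟶ B) (hm : Mono m) (α : S) : Mono (m.f α) := by
  let K : ConfObj D :=
    { F := fun α => kernel (m.f α)
      σ := fun {α β} h => kernel.lift _ ((D.φ h).map (kernel.ι (m.f α)) ≫ A.σ h) (by
        have := hz h
        rw [Category.assoc, ← m.comm h, ← Category.assoc, ← Functor.map_comp, kernel.condition,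
          Functor.map_zero, zero_comp])
      σ_refl := fun α => by
        rw [← cancel_mono (kernel.ι _), kernel.lift_ι, A.σ_refl]
        have h := conf_map_refl D (kernel.ι (m.f α)) (conf_obj_refl D _) (conf_obj_refl D _)
        rw [← cancel_epi (eqToHom (conf_obj_refl D _)), ← Category.assoc, ← h]
        simp
      σ_trans := fun h₁ h₂ => by
        rw [← cancel_mono (kernel.ι _)]
        simp only [Category.assoc, kernel.lift_ι]
        rw [← Category.assoc ((D.φ h₂).map (kernel.lift _ _ _)), ← Functor.map_comp,
          kernel.lift_ι, A.σ_trans h₁ h₂, Functor.map_comp]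
        have h := conf_map_trans D h₁ h₂ (kernel.ι (m.f _)) (conf_obj_trans D h₁ h₂ _)
          (conf_obj_trans D h₁ h₂ _)
        rw [← cancel_epi (eqToHom (conf_obj_trans D h₁ h₂ _)), ← Category.assoc, ← h]
        simp }
  let i : K ⟶ A :=
    { f := fun α => kernel.ι (m.f α)
      comm := fun h => (kernel.lift_ι _ _ _).symm }
  let z : K ⟶ A :=
    { f := fun α => 0
      comm := fun h => by
        have := hz h
        simp }
  have hiz : i = z := by
    rw [← cancel_mono m]
    apply ConfHom.ext
    funext α
    change kernel.ι _ ≫ _ = 0 ≫ _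
    simp
  have h0 : kernel.ι (m.f α) = 0 := congrArg (fun w : K ⟶ A => w.f α) hiz
  exact Preadditive.mono_of_kernel_zero h0

/-- the cofree data from right adjoints -/
noncomputable def cofreeData [Fintype S]
    (D : PosetDiagram.{v, u} S) [∀ α : S, Abelian (D.C α)]
    (ψ : ∀ {α β : S}, β ≤ α → (D.C β ⥤ D.C α))
    (adj : ∀ {α β : S} (h : β ≤ α), D.φ h ⊣ ψ h) (I : ∀ α, D.C α) : CofreeData D I where
  G γ := ∏ᶜ fun a : {α : S // α ≤ γ} => (ψ a.2).obj (I a.1)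
  ev {γ α} h := ((adj h).homEquiv _ _).symm
    (Pi.π (fun a : {α : S // α ≤ γ} => (ψ a.2).obj (I a.1)) ⟨α, h⟩)
  lift t := Pi.lift fun a => (adj a.2).homEquiv _ _ (t a.1 a.2)
  lift_ev t α h := by
    rw [← Adjunction.homEquiv_naturality_left_symm, Pi.lift_π]
    simp
  hom_ext {γ X} p q H := by
    apply Pi.hom_ext
    rintro ⟨α, h⟩
    have := H α h
    rw [← Adjunction.homEquiv_naturality_left_symm,
      ← Adjunction.homEquiv_naturality_left_symm] at this
    exact ((adj h).homEquiv _ _).symm.injective this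

/-- Lemma 2.9: a configuration category `M(S,C)` (finite poset `S`, each
`C(α)` abelian with enough injectives, each `φ_{αβ}` right exact with exact right adjoint
`ψ_{βα}`) has enough injectives: every object admits a monomorphism into an injective. -/
theorem configuration_category_enough_injectives
    (S : Type) [PartialOrder S] [Fintype S]
    (D : PosetDiagram.{v, u} S) [∀ α : S, Abelian (D.C α)]
    (hφ : ∀ {α β : S} (h : β ≤ α), PreservesFiniteColimits (D.φ h))
    (ψ : ∀ {α β : S}, β ≤ α → (D.C β ⥤ D.C α))
    (adj : ∀ {α β : S} (h : β ≤ α), D.φ h ⊣ ψ h)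
    (ψlex : ∀ {α β : S} (h : β ≤ α), PreservesFiniteLimits (ψ h))
    (ψrex : ∀ {α β : S} (h : β ≤ α), PreservesFiniteColimits (ψ h))
    (hinj : ∀ α : S, EnoughInjectives (D.C α)) :
    EnoughInjectives (ConfObj D) := by
  have hz : ∀ {α β : S} (h : β ≤ α), (D.φ h).PreservesZeroMorphisms := by
    intro α β h
    have := (adj h).isLeftAdjoint
    infer_instance
  refine ⟨fun F => ?_⟩
  let K := (cofreeData D ψ adj (fun α => Injective.under (F.F α))).toObj
  exact ⟨{
    J := K.obj
    injective := K.injective_obj (fun m hm => conf_mono_f D hz m hm) (fun α => inferInstance)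
    f := K.liftHom fun α => Injective.ι (F.F α)
    mono := K.mono_liftHom _ fun α => inferInstance }⟩
end

section
/- Let M(S,C) be a configuration category such that each category C(α) has enough injectives and finite cohomological dimension (every object has a finite injective resolution). Then M(S,C) has finite cohomological dimension: every object of M(S,C) admits a finite injective resolution. -/
open CategoryTheory CategoryTheory.Limits

universe w v u

variable {S : Type} [PartialOrder S]

/-- An object of an abelian category has a finite injective resolution. -/
def HasFiniteInjectiveResolution {A : Type*} [Category A] [Abelian A] (X : A) : Prop :=
  ∃ (I : InjectiveResolution X) (n : ℕ), ∀ k : ℕ, n < k → IsZero (I.cocomplex.X k)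


namespace FID
variable {A : Type*} [Category A] [Abelian A]

/-- finite injective dimension -/
def Fid (X : A) : Prop := ∃ n, HasInjectiveDimensionLT X n

lemma Fid.of_isZero {X : A} (h : IsZero X) : Fid X := ⟨0, h.hasInjectiveDimensionLT_zero⟩

lemma Fid.of_injective {X : A} [Injective X] : Fid X := ⟨1, inferInstance⟩

lemma Fid.of_iso {X Y : A} (e : X ≅ Y) (h : Fid X) : Fid Y := by
  obtain ⟨n, hn⟩ := h
  exact ⟨n, hasInjectiveDimensionLT_of_iso e n⟩

lemma Fid.X₂ {T : ShortComplex A} (hT : T.ShortExact) (h₁ : Fid T.X₁) (h₃ : Fid T.X₃) :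
    Fid T.X₂ := by
  obtain ⟨n, hn⟩ := h₁
  obtain ⟨m, hm⟩ := h₃
  exact ⟨max n m, hT.hasInjectiveDimensionLT_X₂ _
    (hasInjectiveDimensionLT_of_ge _ n _ (le_max_left _ _))
    (hasInjectiveDimensionLT_of_ge _ m _ (le_max_right _ _))⟩

lemma Fid.X₁ {T : ShortComplex A} (hT : T.ShortExact) (h₂ : Fid T.X₂) (h₃ : Fid T.X₃) :
    Fid T.X₁ := by
  obtain ⟨n, hn⟩ := h₂
  obtain ⟨m, hm⟩ := h₃
  exact ⟨max n m + 1, hT.hasInjectiveDimensionLT_X₁ _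
    (hasInjectiveDimensionLT_of_ge _ m _ (le_max_right _ _))
    (hasInjectiveDimensionLT_of_ge _ n _ (by omega))⟩

/-- two out of three along a morphism -/
lemma Fid.of_ker_coker {X Y : A} (f : X ⟶ Y) (hY : Fid Y) (hk : Fid (kernel f))
    (hc : Fid (cokernel f)) : Fid X := by
  have h1 : (ShortComplex.mk (Abelian.image.ι f) (cokernel.π f) (kernel.condition _)).ShortExact :=
    { exact := ShortComplex.exact_of_f_is_kernel _ (kernelIsKernel _) }
  have hI : Fid (Abelian.image f) := Fid.X₁ h1 hY hc
  have h2 : (ShortComplex.mk (kernel.ι f) (Abelian.coimage.π f) (cokernel.condition _)).ShortExact :=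
    { exact := ShortComplex.exact_of_g_is_cokernel _ (cokernelIsCokernel _) }
  exact Fid.X₂ h2 hk (hI.of_iso (Abelian.coimageIsoImage f).symm)

lemma Fid.of_res {X : A} (h : HasFiniteInjectiveResolution X) : Fid X := by
  obtain ⟨I, n, hn⟩ := h
  have key : ∀ j k : ℕ, n < j + k → Fid (kernel (I.cocomplex.d k (k+1))) := by
    intro j
    induction j with
    | zero =>
      intro k hk
      exact Fid.of_isZero ((hn k (by omega)).of_mono (kernel.ι _))
    | succ j ih =>
      intro k hk
      have h3 := ih (k+1) (by omega)
      have : (ShortComplex.mk (kernel.ι (I.cocomplex.d k (k+1)))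
          (kernel.lift (I.cocomplex.d (k+1) (k+2)) (I.cocomplex.d k (k+1)) (by simp))
          (by rw [← cancel_mono (kernel.ι _)]; simp)).ShortExact :=
        { exact := by
            apply ShortComplex.exact_of_f_is_kernel
            exact isKernelOfComp (f := kernel.lift (I.cocomplex.d (k+1) (k+2))
              (I.cocomplex.d k (k+1)) (by simp)) (kernel.ι _) (I.cocomplex.d k (k+1))
              (kernelIsKernel _) _ (kernel.lift_ι _ _ _)
          epi_g := (I.exact_succ k).epi_kernelLift }
      exact Fid.X₁ this Fid.of_injective h3
  refine (key (n+1) 0 (by omega)).of_iso ?_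
  exact (IsLimit.conePointUniqueUpToIso I.isLimitKernelFork (kernelIsKernel _)).symm

lemma splice {T : ShortComplex A} (hT : T.ShortExact) (hJ : Injective T.X₂)
    (h : HasFiniteInjectiveResolution T.X₃) : HasFiniteInjectiveResolution T.X₁ := by
  obtain ⟨I, n, hn⟩ := h
  have := hT.mono_f
  have := hT.epi_g
  let ι0 : T.X₃ ⟶ I.cocomplex.X 0 := I.ι.f 0
  have hm : Mono ι0 := inferInstanceAs (Mono (I.ι.f 0))
  have h0 : ι0 ≫ I.cocomplex.d 0 1 = 0 := I.ι_f_zero_comp_complex_d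
  have hex : (ShortComplex.mk ι0 _ h0).Exact :=
    ShortComplex.exact_of_f_is_kernel _ I.isLimitKernelFork
  have w : (T.g ≫ ι0) ≫ I.cocomplex.d 0 1 = 0 := by rw [Category.assoc, h0, comp_zero]
  let K := CochainComplex.augment I.cocomplex (T.g ≫ ι0) w
  have hw : T.f ≫ K.d 0 1 = 0 := by
    change T.f ≫ T.g ≫ ι0 = 0
    simp
  have hf0 : ((CochainComplex.fromSingle₀Equiv K T.X₁).symm ⟨T.f, hw⟩).f 0 = T.f :=
    CochainComplex.fromSingle₀Equiv_symm_apply_f_zero (C := K) (X := T.X₁) T.f hw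
  refine ⟨{ cocomplex := K
            injective := ?_
            ι := (CochainComplex.fromSingle₀Equiv _ _).symm ⟨T.f, hw⟩
            quasiIso := ⟨?_⟩ }, n + 1, ?_⟩
  · rintro (_ | k)
    · exact hJ
    · exact I.injective k
  · rintro (_ | k)
    · rw [CochainComplex.quasiIsoAt₀_iff, ShortComplex.quasiIso_iff_of_zeros]
      · refine (ShortComplex.exact_and_mono_f_iff_of_iso (S₂ := ShortComplex.mk T.f _ hw) ?_).2
          ⟨?_, by dsimp; infer_instance⟩
        · exact ShortComplex.isoMk (Iso.refl _) (Iso.refl _) (Iso.refl _)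
            ((Category.id_comp _).trans (Eq.trans
              hf0.symm
              (Category.comp_id _).symm))
            ((Category.id_comp _).trans (Category.comp_id _).symm)
        · apply ShortComplex.exact_of_f_is_kernel
          exact isKernelCompMono hT.fIsKernel ι0 rfl
      all_goals rfl
    · rw [quasiIsoAt_iff_exactAt]
      · rw [HomologicalComplex.exactAt_iff' _ k (k + 1) (k + 1 + 1) (by simp) (by simp)]
        match k with
        | 0 =>
          have hex2 : (ShortComplex.mk (T.g ≫ ι0) _ w).Exact := by
            let m : ShortComplex.mk (T.g ≫ ι0) _ w ⟶ ShortComplex.mk ι0 _ h0 :=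
              { τ₁ := T.g, τ₂ := 𝟙 _, τ₃ := 𝟙 _ }
            have : Epi m.τ₁ := hT.epi_g
            have : IsIso m.τ₂ := inferInstanceAs (IsIso (𝟙 _))
            have : Mono m.τ₃ := inferInstanceAs (Mono (𝟙 _))
            exact (ShortComplex.exact_iff_of_epi_of_isIso_of_mono m).2 hex
          exact hex2
        | k+1 =>
          exact I.exact_succ k
      · apply CochainComplex.exactAt_succ_single_obj
  · rintro (_ | k) hk
    · omega
    · exact hn k (by omega)

lemma Fid.res [EnoughInjectives A] {X : A} (h : Fid X) : HasFiniteInjectiveResolution X := by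
  obtain ⟨n, hn⟩ := h
  have hi : ∀ (X : A), Injective X → HasFiniteInjectiveResolution X := fun X _ =>
    ⟨InjectiveResolution.self X, 0, fun k hk =>
      HomologicalComplex.isZero_single_obj_X _ _ _ _ (by omega)⟩
  induction n generalizing X with
  | zero => exact hi _ (IsZero.injective (isZero_of_hasInjectiveDimensionLT_zero X))
  | succ n ih =>
    cases n with
    | zero => exact hi _ (injective_iff_hasInjectiveDimensionLT_one.2 hn)
    | succ n =>
      have ip := (EnoughInjectives.presentation X).some
      have hs := ip.shortExact_shortComplex
      refine splice hs ip.injective (ih ?_)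
      exact (hs.hasInjectiveDimensionLT_X₃_iff n ip.injective).2 hn

end FID

namespace FID

/-- right adjoints of the transition functors -/
structure RA {S : Type} [PartialOrder S] (D : PosetDiagram.{v, u} S) where
  ψ : ∀ {α β : S}, β ≤ α → (D.C β ⥤ D.C α)
  adj : ∀ {α β : S} (h : β ≤ α), D.φ h ⊣ ψ h

section
variable {D : PosetDiagram.{v, u} S} [∀ α, Abelian (D.C α)]

lemma tr_eq {α β γ : S} (h₁ : β ≤ α) (h₂ : γ ≤ β) (X : D.C α) :
    (D.φ h₂).obj ((D.φ h₁).obj X) = (D.φ (h₂.trans h₁)).obj X := by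
  rw [D.φ_trans h₁ h₂]; rfl

lemma rf_eq {α : S} (X : D.C α) : X = (D.φ (le_refl α)).obj X := by
  rw [D.φ_refl]; rfl

lemma tr_nat {α β γ : S} (h₁ : β ≤ α) (h₂ : γ ≤ β) {X Y : D.C α} (f : X ⟶ Y) :
    (D.φ h₂).map ((D.φ h₁).map f) ≫ eqToHom (tr_eq h₁ h₂ Y) =
      eqToHom (tr_eq h₁ h₂ X) ≫ (D.φ (h₂.trans h₁)).map f := by
  have := Functor.congr_hom (D.φ_trans h₁ h₂) f
  rw [this]; simp

lemma rf_nat {α : S} {X Y : D.C α} (f : X ⟶ Y) :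
    f ≫ eqToHom (rf_eq Y) = eqToHom (rf_eq X) ≫ (D.φ (le_refl α)).map f := by
  have := Functor.congr_hom (D.φ_refl α) f
  rw [this]; simp

instance (α β : S) : Finite (PLift (α ≤ β)) := Finite.of_subsingleton

variable (R : RA D)

noncomputable def P {α : S} (X : D.C α) (β : S) : D.C β :=
  ∏ᶜ fun h : PLift (α ≤ β) => (R.ψ h.down).obj X

noncomputable def πP {α : S} (X : D.C α) {β : S} (h : α ≤ β) : P R X β ⟶ (R.ψ h).obj X :=
  Pi.π (fun h : PLift (α ≤ β) => (R.ψ h.down).obj X) ⟨h⟩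

noncomputable def ev {α β : S} (h : α ≤ β) (X : D.C α) : (D.φ h).obj (P R X β) ⟶ X :=
  (D.φ h).map (πP R X h) ≫ (R.adj h).counit.app X

noncomputable def lft {α β : S} {X : D.C α} {Y : D.C β} (a : ∀ h : α ≤ β, (D.φ h).obj Y ⟶ X) :
    Y ⟶ P R X β :=
  Pi.lift fun h : PLift (α ≤ β) => (R.adj h.down).homEquiv _ _ (a h.down)

lemma lft_πP {α β : S} {X : D.C α} {Y : D.C β} (a : ∀ h : α ≤ β, (D.φ h).obj Y ⟶ X)
    (h : α ≤ β) : lft R a ≫ πP R X h = (R.adj h).homEquiv _ _ (a h) :=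
  Pi.lift_π _ _

lemma lft_ev {α β : S} {X : D.C α} {Y : D.C β} (a : ∀ h : α ≤ β, (D.φ h).obj Y ⟶ X)
    (h : α ≤ β) : (D.φ h).map (lft R a) ≫ ev R h X = a h := by
  rw [ev, ← Functor.map_comp_assoc, lft_πP]
  exact ((R.adj h).homEquiv_counit (g := (R.adj h).homEquiv _ _ (a h))).symm.trans (by simp)

lemma P_ext {α β : S} {X : D.C α} {Y : D.C β} {f g : Y ⟶ P R X β}
    (hfg : ∀ h : α ≤ β, (D.φ h).map f ≫ ev R h X = (D.φ h).map g ≫ ev R h X) : f = g := by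
  apply Pi.hom_ext
  rintro ⟨h⟩
  change f ≫ πP R X h = g ≫ πP R X h
  apply ((R.adj h).homEquiv _ _).symm.injective
  have := hfg h
  simp only [ev, ← Functor.map_comp_assoc] at this
  rw [Adjunction.homEquiv_counit, Adjunction.homEquiv_counit]
  simpa using this

noncomputable abbrev jobj {α : S} (X : D.C α) : ConfObj D where
  F := P R X
  σ {β γ} h := lft R fun h' : α ≤ γ => eqToHom (tr_eq h h' _) ≫ ev R (h'.trans h) X
  σ_refl β := by
    apply P_ext; intro h
    rw [lft_ev, eqToHom_map]
  σ_trans {β γ δ} h₁ h₂ := by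
    apply P_ext; intro h
    rw [lft_ev, Functor.map_comp, Functor.map_comp, Category.assoc, Category.assoc, lft_ev,
      reassoc_of% (tr_nat h₂ h), lft_ev, eqToHom_map]
    simp

lemma jobj_σ_ev {α β γ : S} (X : D.C α) (h : γ ≤ β) (h' : α ≤ γ) :
    (D.φ h').map ((jobj R X).σ h) ≫ ev R h' X = eqToHom (tr_eq h h' _) ≫ ev R (h'.trans h) X :=
  lft_ev R (fun h' : α ≤ γ => eqToHom (tr_eq h h' _) ≫ ev R (h'.trans h) X) h'

noncomputable def cou {α : S} (X : D.C α) : P R X α ⟶ X :=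
  eqToHom (rf_eq _) ≫ ev R le_rfl X

noncomputable def jEquiv (α : S) (F : ConfObj D) (X : D.C α) :
    (F.F α ⟶ X) ≃ (F ⟶ jobj R X) where
  toFun u :=
    { f := fun β => lft R fun h => F.σ h ≫ u
      comm := by
        intro β γ h
        apply P_ext; intro h'
        rw [Functor.map_comp, Category.assoc, jobj_σ_ev, reassoc_of% (tr_nat h h'), lft_ev,
          Functor.map_comp, Category.assoc, lft_ev, F.σ_trans h h']
        simp }
  invFun g := g.f α ≫ cou R X
  left_inv u := by
    change lft R (fun h => F.σ h ≫ u) ≫ cou R X = u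
    rw [cou, reassoc_of% rf_nat, lft_ev, F.σ_refl]
    simp
  right_inv g := by
    apply ConfHom.ext; funext β
    apply P_ext; intro h
    change (D.φ h).map (lft R (fun h => F.σ h ≫ g.f α ≫ cou R X)) ≫ _ = _
    rw [lft_ev, ← Category.assoc, ← g.comm h, Category.assoc]
    congr 1
    rw [cou, reassoc_of% rf_nat, jobj_σ_ev]
    simp

noncomputable def jF (α : S) : D.C α ⥤ ConfObj D :=
  Adjunction.rightAdjointOfEquiv (F := evalF D α) (G_obj := fun X => jobj R X)
    (fun F X => jEquiv R α F X) (by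
      intro F F' X f g
      apply (jEquiv R α F X).symm.injective
      refine ((jEquiv R α F X).symm_apply_apply _).trans ?_
      have := (jEquiv R α F' X).symm_apply_apply g
      change f.f α ≫ g = _
      conv_lhs => rw [← this]
      exact (Category.assoc _ _ _).symm)

noncomputable def jAdj (α : S) : evalF D α ⊣ jF R α :=
  Adjunction.adjunctionOfEquivRight _ _

lemma jF_obj {α : S} (X : D.C α) : (jF R α).obj X = jobj R X := rfl

end
end FID

namespace FID

lemma epi_aux {C : Type*} [Category C] {A B A' B' : C} (g : A ⟶ B) (p : A ⟶ A') (q : B ⟶ B')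
    [IsIso p] [IsIso q] (k : A' ⟶ B') [Epi k] (w : g ≫ q = p ≫ k) : Epi g := by
  rw [← IsIso.eq_comp_inv] at w
  rw [w]
  infer_instance

lemma isIso_aux {C : Type*} [Category C] {A B : C} (g : A ⟶ B) (q : B ⟶ A)
    [IsIso q] (w : g ≫ q = 𝟙 _) : IsIso g := by
  rw [← IsIso.eq_comp_inv] at w
  rw [w]
  infer_instance

section
variable {D : PosetDiagram.{v, u} S} [∀ α, Abelian (D.C α)] (R : RA D)

instance isIso_πP {α β : S} (X : D.C α) (h : α ≤ β) : IsIso (πP R X h) := by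
  let _ : Unique (PLift (α ≤ β)) := ⟨⟨⟨h⟩⟩, fun _ => rfl⟩
  exact (productUniqueIso (fun h : PLift (α ≤ β) => (R.ψ h.down).obj X)).isIso_hom

lemma isZero_P {α β : S} (X : D.C α) (h : ¬ α ≤ β) : IsZero (P R X β) := by
  rw [IsZero.iff_id_eq_zero]
  exact P_ext R fun h' => (h h').elim

lemma σ_cou {α β : S} (X : D.C α) (h : α ≤ β) : (jobj R X).σ h ≫ cou R X = ev R h X := by
  rw [cou, reassoc_of% rf_nat, jobj_σ_ev]
  simp

lemma isIso_cou {α : S} (X : D.C α) : IsIso (cou R X) := by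
  have : (D.φ (le_refl α)).IsEquivalence := by rw [D.φ_refl]; infer_instance
  have : (R.ψ (le_refl α)).IsEquivalence :=
    (R.adj (le_refl α)).isEquivalence_right_of_isEquivalence_left
  unfold cou ev
  infer_instance

lemma jF_map_π {α β : S} {X Y : D.C α} (f : X ⟶ Y) (h : α ≤ β) :
    ((jF R α).map f).f β ≫ πP R Y h = πP R X h ≫ (R.ψ h).map f := by
  change lft R (fun h => (jobj R X).σ h ≫ (𝟙 _ ≫ cou R X) ≫ f) ≫ πP R Y h = _
  rw [lft_πP, Category.id_comp, reassoc_of% (σ_cou R X h), ev, Category.assoc,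
    ← Adjunction.counit_naturality, ← Functor.map_comp_assoc, ← Adjunction.homEquiv_counit]
  exact ((R.adj h).homEquiv _ _).apply_symm_apply _

lemma epi_of_pointwise {F G : ConfObj D} (f : F ⟶ G) (h : ∀ α, Epi (f.f α)) : Epi f := by
  constructor
  intro Z a b hab
  apply ConfHom.ext; funext α
  have := congrArg (fun k => ConfHom.f k α) hab
  have h2 := h α
  exact (cancel_epi (f.f α)).1 this

lemma jF_epi (hψ : ∀ {α β : S} (h : β ≤ α), PreservesFiniteColimits (R.ψ h))
    {α : S} {X Y : D.C α} (f : X ⟶ Y) [Epi f] : Epi ((jF R α).map f) := by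
  apply epi_of_pointwise
  intro β
  by_cases h : α ≤ β
  · have := hψ h
    exact epi_aux (A := P R X β) (B := P R Y β) _ (πP R X h) (πP R Y h) ((R.ψ h).map f)
      (jF_map_π R f h)
  · exact ⟨fun a b _ => (isZero_P R Y h).eq_of_src _ _⟩

variable [Abelian (ConfObj D)]

lemma zero_f (R : RA D) {F G : ConfObj D} (α : S) : (0 : F ⟶ G).f α = 0 := by
  have := (jAdj R α).isLeftAdjoint
  exact (evalF D α).map_zero F G

noncomputable def kobj {F G : ConfObj D} (f : F ⟶ G) : ConfObj D where
  F α := kernel (f.f α)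
  σ {α β} h := kernel.lift (f.f β) ((D.φ h).map (kernel.ι (f.f α)) ≫ F.σ h) (by
    have := (R.adj h).isLeftAdjoint
    rw [Category.assoc, ← f.comm h, ← Functor.map_comp_assoc, kernel.condition,
      Functor.map_zero, zero_comp])
  σ_refl α := by
    rw [← cancel_mono (kernel.ι _), kernel.lift_ι, F.σ_refl]
    have := rf_nat (kernel.ι (f.f α))
    rw [← cancel_epi (eqToHom (rf_eq (kernel (f.f α)))), ← Category.assoc, ← this]
    simp
  σ_trans {α β γ} h₁ h₂ := by
    rw [← cancel_mono (kernel.ι _), kernel.lift_ι, F.σ_trans h₁ h₂]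
    have := tr_nat h₁ h₂ (kernel.ι (f.f α))
    rw [Category.assoc, Category.assoc, kernel.lift_ι, ← Functor.map_comp_assoc, kernel.lift_ι,
      Functor.map_comp, Category.assoc,
      ← cancel_epi (eqToHom (tr_eq h₁ h₂ (kernel (f.f α)))), ← Category.assoc, ← this]
    simp

noncomputable def kι {F G : ConfObj D} (f : F ⟶ G) : kobj R f ⟶ F where
  f α := kernel.ι (f.f α)
  comm {α β} h := (kernel.lift_ι _ _ _).symm

lemma evalF_mono (R : RA D) {F G : ConfObj D} (f : F ⟶ G) [Mono f] (α : S) : Mono (f.f α) := by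
  have h : kι R f = 0 := by
    rw [← cancel_mono f]
    apply ConfHom.ext; funext β
    rw [zero_comp, zero_f R]
    exact kernel.condition _
  apply Preadditive.mono_of_kernel_zero
  have := congrArg (fun k => ConfHom.f k α) h
  exact this.trans (zero_f R α)

lemma evalF_pm (R : RA D) (α : S) : (evalF D α).PreservesMonomorphisms :=
  ⟨fun f _ => evalF_mono R f α⟩

lemma jF_inj {α : S} (X : D.C α) [hX : Injective X] : Injective ((jF R α).obj X) := by
  have := evalF_pm R α
  exact (jAdj R α).map_injective X hX

lemma jF_fid (hψ : ∀ {α β : S} (h : β ≤ α), PreservesFiniteColimits (R.ψ h))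
    {α : S} [EnoughInjectives (D.C α)] {X : D.C α} (h : Fid X) : Fid ((jF R α).obj X) := by
  obtain ⟨n, hn⟩ := h
  have := (jAdj R α).isRightAdjoint
  induction n generalizing X with
  | zero =>
    exact Fid.of_isZero ((jF R α).map_isZero (isZero_of_hasInjectiveDimensionLT_zero X))
  | succ n ih =>
    cases n with
    | zero =>
      have := injective_iff_hasInjectiveDimensionLT_one.2 hn
      have := jF_inj R X
      exact Fid.of_injective
    | succ n =>
      have ip := (EnoughInjectives.presentation X).some
      have hs := ip.shortExact_shortComplex
      have h3 := ih ((hs.hasInjectiveDimensionLT_X₃_iff n ip.injective).2 hn)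
      have hm := hs.mono_f
      have he := hs.epi_g
      have hs' : (ip.shortComplex.map (jF R α)).ShortExact :=
        { exact := hs.exact.map_of_mono_of_preservesKernel (jF R α) hm inferInstance
          mono_f := (jF R α).map_mono ip.f
          epi_g := jF_epi R hψ _ }
      have := ip.injective
      have := jF_inj R ip.J
      exact Fid.X₁ hs' (Fid.of_injective (X := (jF R α).obj ip.J)) h3

lemma enough [Finite S] (R : RA D) (hinj : ∀ α : S, EnoughInjectives (D.C α)) :
    EnoughInjectives (ConfObj D) := by
  constructor
  intro F
  let J : S → ConfObj D := fun α => (jF R α).obj (Injective.under (F.F α))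
  have : ∀ α, Injective (J α) := fun α => jF_inj R _
  let m : F ⟶ ∏ᶜ J := Pi.lift fun α => jEquiv R α F _ (Injective.ι (F.F α))
  refine ⟨⟨∏ᶜ J, inferInstance, m, ⟨?_⟩⟩⟩
  intro Z a b hab
  apply ConfHom.ext; funext α
  rw [← cancel_mono (Injective.ι (F.F α))]
  have h1 : m ≫ Pi.π J α = jEquiv R α F _ (Injective.ι (F.F α)) := Pi.lift_π _ _
  have h2 : a ≫ jEquiv R α F _ (Injective.ι (F.F α)) =
      b ≫ jEquiv R α F _ (Injective.ι (F.F α)) := by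
    rw [← h1]
    exact (Category.assoc _ _ _).symm.trans ((congrArg (· ≫ Pi.π J α) hab).trans
      (Category.assoc _ _ _))
  have h3 : ConfHom.f (jEquiv R α F _ (Injective.ι (F.F α))) α ≫ cou R _ = Injective.ι (F.F α) :=
    (jEquiv R α F _).symm_apply_apply _
  rw [← h3]
  have h4 := congrArg (fun k => ConfHom.f k α ≫ cou R _) h2
  simpa using h4

lemma isZero_of_pointwise (R : RA D) {F : ConfObj D} (h : ∀ α, IsZero (F.F α)) : IsZero F := by
  rw [IsZero.iff_id_eq_zero]
  apply ConfHom.ext; funext α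
  exact (h α).eq_of_src _ _

lemma main [Finite S] (hψ : ∀ {α β : S} (h : β ≤ α), PreservesFiniteColimits (R.ψ h))
    (hinj : ∀ α : S, EnoughInjectives (D.C α)) (hfd : ∀ (α : S) (X : D.C α), Fid X)
    (n : ℕ) : ∀ (U : Set S), IsUpperSet U → U.ncard = n → ∀ F : ConfObj D, SuppIn F U → Fid F := by
  induction n with
  | zero =>
    intro U hU hn F hF
    have : U = ∅ := (Set.ncard_eq_zero U.toFinite).1 hn
    subst this
    exact Fid.of_isZero (isZero_of_pointwise R fun α => hF α (by simp))
  | succ n ih =>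
    intro U hU hn F hF
    have hne : U.Nonempty := by
      rw [← Set.ncard_pos]; omega
    obtain ⟨α, hα⟩ := U.toFinite.exists_minimal hne
    have hU' : IsUpperSet (U \ {α}) := by
      intro a b hab ha
      refine ⟨hU hab ha.1, fun hb => ha.2 ?_⟩
      rw [Set.mem_singleton_iff] at hb
      subst hb
      exact le_antisymm hab (hα.2 ha.1 hab)
    have hc : (U \ {α}).ncard = n := by
      rw [Set.ncard_diff_singleton_of_mem hα.1]; omega
    let f : F ⟶ (jF R α).obj (F.F α) := jEquiv R α F _ (𝟙 _)
    have hf : f.f α ≫ cou R (F.F α) = 𝟙 (F.F α) := (jEquiv R α F _).symm_apply_apply _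
    have := isIso_cou R (F.F α)
    have hiso : IsIso (f.f α) := isIso_aux (B := P R (F.F α) α) _ (cou R (F.F α)) hf
    apply Fid.of_ker_coker f
    · exact jF_fid R hψ (hfd α _)
    · refine ih _ hU' hc _ ?_
      intro β hβ
      have hm := evalF_mono R (kernel.ι f) β
      by_cases hb : β = α
      · subst hb
        have h0 : (kernel.ι f).f β ≫ f.f β = 0 := by
          rw [← conf_comp_f, kernel.condition, zero_f R]
        exact IsZero.of_mono_eq_zero _ ((cancel_mono (f.f β)).1 (h0.trans zero_comp.symm))
      · exact (hF β fun h => hβ ⟨h, hb⟩).of_mono ((kernel.ι f).f β)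
    · refine ih _ hU' hc _ ?_
      intro β hβ
      have hla := (jAdj R β).isLeftAdjoint
      have he : Epi ((cokernel.π f).f β) :=
        inferInstanceAs (Epi ((evalF D β).map (cokernel.π f)))
      by_cases hb : β = α
      · subst hb
        have h0 : f.f β ≫ (cokernel.π f).f β = 0 := by
          rw [← conf_comp_f, cokernel.condition, zero_f R]
        exact IsZero.of_epi_eq_zero _ ((cancel_epi (f.f β)).1 (h0.trans comp_zero.symm))
      · have hz : IsZero (P R (F.F α) β) :=
          isZero_P R _ fun h => hβ ⟨hU h hα.1, hb⟩
        exact IsZero.of_epi (f := (cokernel.π f).f β) hz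

end
end FID

/-- Proposition 2.10: a configuration category `M(S,C)` in which every
`C(α)` has enough injectives and finite cohomological dimension (every object admits a
finite injective resolution) itself has finite cohomological dimension: every object of
`M(S,C)` admits a finite injective resolution. -/
theorem configuration_category_finite_cohomological_dimension
    (S : Type) [PartialOrder S] [Fintype S]
    (D : PosetDiagram.{v, u} S) [∀ α : S, Abelian (D.C α)]
    (hφ : ∀ {α β : S} (h : β ≤ α), PreservesFiniteColimits (D.φ h))
    (ψ : ∀ {α β : S}, β ≤ α → (D.C β ⥤ D.C α))
    (adj : ∀ {α β : S} (h : β ≤ α), D.φ h ⊣ ψ h)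
    (ψlex : ∀ {α β : S} (h : β ≤ α), PreservesFiniteLimits (ψ h))
    (ψrex : ∀ {α β : S} (h : β ≤ α), PreservesFiniteColimits (ψ h))
    (hinj : ∀ α : S, EnoughInjectives (D.C α))
    (hfd : ∀ (α : S) (X : D.C α), HasFiniteInjectiveResolution X)
    [Abelian (ConfObj D)] :
    ∀ F : ConfObj D, HasFiniteInjectiveResolution F := by
  intro F
  let R : FID.RA D := ⟨ψ, adj⟩
  have := FID.enough R hinj
  exact (FID.main R ψrex hinj (fun α X => FID.Fid.of_res (hfd α X)) _ Set.univ isUpperSet_univ rfl F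
    (fun α h => (h (Set.mem_univ α)).elim)).res
end
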